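/- Let I be a radical order ideal of the positively ordered monoid M and let F : M → M be ≥_I-increasing, i.e. f ≥_I g implies F(f) ≥_I F(g). Set T = {f ∈ M : F(f) ≥_I f} and Q = {T_g : g ∈ M}. Assume T is nonempty and every subset T₀ ⊆ T with card T₀ < κ(Q[T], I) is Q-bounded in T. Then there exists h ∈ M with F(h) ~_I h. -/

import Mathlib

open Cardinal

/-- A positively ordered (p.o.) monoid. -/
class POMonoid (M : Type*) extends CommMonoid M, PartialOrder M, OrderBot M where
  le_one : ∀ f : M, f ≤ 1
  mul_le_mul_of_le : ∀ {f g : M}, f ≤ g → ∀ h : M, f * h ≤ g * h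

/-- An order ideal: downward closed set. -/
def IsOrderIdeal {M : Type*} [POMonoid M] (I : Set M) : Prop :=
  ∀ f ∈ I, ∀ g : M, g ≤ f → g ∈ I

/-- A radical set: `f ∈ I` whenever `f ^ n ∈ I` for some `n ≥ 1`. -/
def IsRadicalSet {M : Type*} [POMonoid M] (I : Set M) : Prop :=
  ∀ f : M, ∀ n : ℕ, 1 ≤ n → f ^ n ∈ I → f ∈ I

/-- `D` is mutually `I`-disjoint. -/
def MutuallyDisjointMod {M : Type*} [POMonoid M] (I D : Set M) : Prop :=
  D ∩ I = ∅ ∧ ∀ f ∈ D, ∀ g ∈ D, f ≠ g → f * g ∈ I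

/-- `κ(T, I)`. -/
noncomputable def kappa {M : Type*} [POMonoid M] (T I : Set M) : Cardinal :=
  sInf {c : Cardinal | ∀ D : Set M, D ⊆ T → MutuallyDisjointMod I D → #D < c}

/-- `𝒬[T]`. -/
def projImage {M : Type*} [POMonoid M] (𝒬 : Set (M → M)) (T : Set M) : Set M :=
  {h : M | ∃ Q ∈ 𝒬, ∃ f ∈ T, Q f = h}

/-- `h` is a `π`-bound in `T` for `T₀`. -/
def IsPiBound {M : Type*} [POMonoid M] (π : M → M → M) (T T₀ : Set M)
    (h : M) : Prop :=
  h ∈ T ∧ ∀ f ∈ T₀, ∃ g ∈ T, π h f ≤ π g g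

/-- `T₀` is `𝒬`-bounded in `T`. -/
def QBounded {M : Type*} [POMonoid M] (𝒬 : Set (M → M)) (T T₀ : Set M) : Prop :=
  ∀ π : M → M → M, (∀ h : M, π h ∈ 𝒬) → ∃ h : M, IsPiBound π T T₀ h

/-- The set of translates `T_g : f ↦ g * f`. -/
def translates (M : Type*) [POMonoid M] : Set (M → M) :=
  {Q : M → M | ∃ g : M, Q = fun f => g * f}

/-- The preorder `f ≥_I g`. -/
def geMod {M : Type*} [POMonoid M] (I : Set M) (f g : M) : Prop :=
  ∀ h : M, f * h ∈ I → g * h ∈ I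

/-- `f ~_I g`. -/
def simMod {M : Type*} [POMonoid M] (I : Set M) (f g : M) : Prop :=
  geMod I f g ∧ geMod I g f

theorem IsOrderIdeal.mul_mem_left {M : Type*} [POMonoid M] {I : Set M} (hI : IsOrderIdeal I)
    (a : M) {b : M} (hb : b ∈ I) : a * b ∈ I :=
  hI b hb _ (by simpa using POMonoid.mul_le_mul_of_le (POMonoid.le_one a) b)

theorem MutuallyDisjointMod.mk_lt_kappa {M : Type*} [POMonoid M] {I T D : Set M}
    (hDT : D ⊆ T) (hD : MutuallyDisjointMod I D) : #D < kappa T I :=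
  csInf_mem (s := {c : Cardinal | ∀ D : Set M, D ⊆ T → MutuallyDisjointMod I D → #D < c})
    ⟨Order.succ #M, fun D _ _ => Order.lt_succ_of_le (mk_set_le D)⟩ D hDT hD

/-- A maximal mutually `I`-disjoint subset `D` of `S` detects membership in `I`: an element of `S`
that multiplies `D` into `I` already lies in `I`. -/
theorem exists_maximal_mutuallyDisjointMod {M : Type*} [POMonoid M] {I : Set M}
    (hrad : IsRadicalSet I) (S : Set M) :
    ∃ D ⊆ S, MutuallyDisjointMod I D ∧ ∀ x ∈ S, (∀ d ∈ D, x * d ∈ I) → x ∈ I := by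
  obtain ⟨D, hD⟩ := zorn_subset {D : Set M | D ⊆ S ∧ MutuallyDisjointMod I D} <| by
    intro c hc hchain
    refine ⟨⋃₀ c, ⟨Set.sUnion_subset fun D hD => (hc hD).1, ?_, ?_⟩,
      fun D hD => Set.subset_sUnion_of_mem hD⟩
    · refine Set.eq_empty_iff_forall_notMem.2 ?_
      rintro x ⟨⟨D, hD, hxD⟩, hxI⟩
      exact Set.eq_empty_iff_forall_notMem.1 (hc hD).2.1 x ⟨hxD, hxI⟩
    · rintro f ⟨D, hD, hf⟩ g ⟨E, hE, hg⟩ hfg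
      rcases hchain.total hD hE with h | h
      · exact (hc hE).2.2 f (h hf) g hg hfg
      · exact (hc hD).2.2 f hf g (h hg) hfg
  refine ⟨D, hD.prop.1, hD.prop.2, fun x hxS hx => ?_⟩
  by_contra hxI
  have hins : insert x D ∈ {D : Set M | D ⊆ S ∧ MutuallyDisjointMod I D} := by
    refine ⟨Set.insert_subset hxS hD.prop.1, ?_, ?_⟩
    · rw [Set.insert_inter_of_notMem hxI, hD.prop.2.1]
    · rintro f (rfl | hf) g (rfl | hg) hfg
      · exact absurd rfl hfg
      · exact hx g hg
      · rw [mul_comm]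
        exact hx f hf
      · exact hD.prop.2.2 f hf g hg hfg
  have hxD : x ∈ D := hD.le_of_ge hins (Set.subset_insert x D) (Set.mem_insert x D)
  exact hxI (hrad x 2 one_le_two (by simpa only [pow_two] using hx x hxD))

/-- Tarski-type fixed point: a `≥_I`-increasing map `F` with nonempty,
suitably directed set `T = {f : F f ≥_I f}` has an `~_I`-fixed point. -/
theorem stmt15 {M : Type*} [POMonoid M] (I : Set M)
    (hord : IsOrderIdeal I) (hrad : IsRadicalSet I) (F : M → M)
    (hF : ∀ f g : M, geMod I f g → geMod I (F f) (F g))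
    (hTne : {f : M | geMod I (F f) f}.Nonempty)
    (hdir : ∀ T₀ : Set M, T₀ ⊆ {f : M | geMod I (F f) f} →
      #T₀ < kappa (projImage (translates M) {f : M | geMod I (F f) f}) I →
      QBounded (translates M) {f : M | geMod I (F f) f} T₀) :
    ∃ h : M, simMod I (F h) h := by
  by_contra! hfix
  set T : Set M := {f : M | geMod I (F f) f}
  have hwit : ∀ h : M, ∃ g : M, h ∈ T → g * h ∈ I ∧ g * F h ∉ I := by
    intro h
    by_cases hT : h ∈ T
    · have hnot : ¬ geMod I h (F h) := fun hge => hfix h ⟨hT, hge⟩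
      simp only [geMod, not_forall] at hnot
      obtain ⟨g, hg, hFg⟩ := hnot
      exact ⟨g, fun _ => ⟨by rwa [mul_comm], by rwa [mul_comm]⟩⟩
    · exact ⟨1, fun h => absurd h hT⟩
  choose w hw using hwit
  obtain ⟨D, hDS, hD, hDmax⟩ :=
    exists_maximal_mutuallyDisjointMod hrad (projImage (translates M) T)
  have hfactor : ∀ d : D, ∃ f ∈ T, ∃ a : M, a * f = d := by
    rintro ⟨d, hd⟩
    obtain ⟨_, ⟨a, rfl⟩, f, hf, hfd⟩ := hDS hd
    exact ⟨f, hf, a, hfd⟩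
  choose t htT a hat using hfactor
  obtain ⟨h, hhT, hbound⟩ := hdir (Set.range t) (Set.range_subset_iff.2 htT)
    (mk_range_le.trans_lt (hD.mk_lt_kappa hDS)) (fun h f => w h * f) (fun h => ⟨w h, rfl⟩)
  refine (hw h hhT).2 (hDmax _ ⟨_, ⟨w h, rfl⟩, F h, hF _ _ hhT, rfl⟩ fun d hd => ?_)
  obtain ⟨g, hgT, hle⟩ := hbound _ ⟨⟨d, hd⟩, rfl⟩
  have hmem : w h * t ⟨d, hd⟩ ∈ I := hord _ (hw g hgT).1 _ hle
  have hd_eq : d = a ⟨d, hd⟩ * t ⟨d, hd⟩ := (hat ⟨d, hd⟩).symm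
  have hprod : w h * F h * d = F h * a ⟨d, hd⟩ * (w h * t ⟨d, hd⟩) := by
    conv_lhs => rw [hd_eq]
    ac_rfl
  rw [hprod]
  exact hord.mul_mem_left _ hmem
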